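/- arXiv:2602.12027 — 2 statements merged into one kernel-verified Lean document; each statement's English description precedes it below -/
import Mathlib

section
/- Let μ be a probability density on ℝ^d and ν_1,…,ν_K probability densities with pairwise disjoint supports D_1,…,D_K, each with μ(D_k) > 0. Define the conditioned densities μ_k = μ 1_{D_k} / μ(D_k) and the conditional weights q*_k = μ(D_k) / Σ_{ℓ=1}^K μ(D_ℓ). Assume KL(ν_k|μ_k) < ∞ for all k. Then the function J(p) = Σ_{k=1}^K p_k ∫_{D_k} (U + ln(p_k ν_k)) ν_k (with U = -ln μ and the convention 0 ln 0 = 0) admits a unique minimizer over the simplex Δ_K, given by p̄*_k = q*_k e^{-KL(ν_k|μ_k)} / Σ_{ℓ=1}^K q*_ℓ e^{-KL(ν_ℓ|μ_ℓ)}. In particular, if ν_k = μ_k for all k, the minimizer is p̄* = q*. -/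
open MeasureTheory

theorem sub_le_mul_log_sub_log {p q : ℝ} (hp : 0 ≤ p) (hq : 0 < q) :
    p - q ≤ p * (Real.log p - Real.log q) := by
  rcases hp.eq_or_lt with rfl | hp
  · simpa using hq.le
  · have h := Real.log_le_sub_one_of_pos (div_pos hq hp)
    rw [Real.log_div hq.ne' hp.ne'] at h
    have h' := mul_le_mul_of_nonneg_left h hp.le
    have e : p * (q / p - 1) = q - p := by field_simp
    linarith

theorem sub_lt_mul_log_sub_log {p q : ℝ} (hp : 0 ≤ p) (hq : 0 < q) (hpq : p ≠ q) :
    p - q < p * (Real.log p - Real.log q) := by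
  rcases hp.eq_or_lt with rfl | hp
  · simpa using hq
  · have hne : q / p ≠ 1 := fun h => hpq ((div_eq_one_iff_eq hp.ne').1 h).symm
    have h := Real.log_lt_sub_one_of_pos (div_pos hq hp) hne
    rw [Real.log_div hq.ne' hp.ne'] at h
    have h' := mul_lt_mul_of_pos_left h hp
    have e : p * (q / p - 1) = q - p := by field_simp
    linarith

/-- Gibbs' inequality on a finite type. -/
theorem sum_mul_log_sub_log_nonneg {ι : Type*} [Fintype ι] {p q : ι → ℝ}
    (hp : ∀ i, 0 ≤ p i) (hq : ∀ i, 0 < q i) (hsum : ∑ i, p i = ∑ i, q i) :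
    0 ≤ ∑ i, p i * (Real.log (p i) - Real.log (q i)) := by
  have h := Finset.sum_le_sum fun i (_ : i ∈ Finset.univ) =>
    sub_le_mul_log_sub_log (hp i) (hq i)
  rwa [Finset.sum_sub_distrib, hsum, sub_self] at h

/-- The strict case of Gibbs' inequality on a finite type. -/
theorem sum_mul_log_sub_log_pos {ι : Type*} [Fintype ι] {p q : ι → ℝ}
    (hp : ∀ i, 0 ≤ p i) (hq : ∀ i, 0 < q i) (hsum : ∑ i, p i = ∑ i, q i) (hne : p ≠ q) :
    0 < ∑ i, p i * (Real.log (p i) - Real.log (q i)) := by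
  obtain ⟨j, hj⟩ := Function.ne_iff.1 hne
  have h := Finset.sum_lt_sum
    (fun i (_ : i ∈ Finset.univ) => sub_le_mul_log_sub_log (hp i) (hq i))
    ⟨j, Finset.mem_univ j, sub_lt_mul_log_sub_log (hp j) (hq j) hj⟩
  rwa [Finset.sum_sub_distrib, hsum, sub_self] at h

/-- Adding a constant to `g` shifts its integral against a probability density supported in `D`
by that constant. -/
theorem setIntegral_eq_add_of_density {X : Type*} [MeasurableSpace X] {m : Measure X} {D : Set X}
    (hD : MeasurableSet D) {f g h : X → ℝ} (c : ℝ) (hf : ∫ x, f x ∂m = 1)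
    (hsupp : ∀ x ∉ D, f x = 0) (hg : IntegrableOn (fun x => g x * f x) D m)
    (hh : ∀ x ∈ D, h x = g x * f x + c * f x) :
    ∫ x in D, h x ∂m = (∫ x in D, g x * f x ∂m) + c := by
  have hfi : Integrable f m := .of_integral_ne_zero (by rw [hf]; exact one_ne_zero)
  rw [setIntegral_congr_fun hD hh, integral_add hg (hfi.integrableOn.const_mul c),
    integral_const_mul, setIntegral_eq_integral_of_forall_compl_eq_zero hsupp, hf, mul_one]

/-- With `μ` a (positive) probability density, `ν k` probability densities
with pairwise disjoint supports `D k` of positive `μ`-mass, `μ_k = μ 1_{D_k}/μ(D_k)`,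
`q*_k = μ(D_k)/∑_ℓ μ(D_ℓ)` and `KL(ν_k|μ_k) < ∞`, the function
`J(p) = ∑ k, p k ∫_{D k} (U + ln (p k ν k)) ν k` (with `U = -ln μ` and the convention
`0 ln 0 = 0`) admits a unique minimizer over the simplex `Δ_K`, given by
`p̄*_k = q*_k e^{-KL(ν_k|μ_k)} / ∑_ℓ q*_ℓ e^{-KL(ν_ℓ|μ_ℓ)}`; in particular, if `ν_k = μ_k`
for all `k`, the minimizer is `q*`. -/
theorem stmt_12
    (d K : ℕ) (hK : 0 < K)
    (μ : EuclideanSpace ℝ (Fin d) → ℝ)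
    (hμmeas : Measurable μ)
    (hμpos : ∀ x, 0 < μ x)
    (hμprob : ∫ x, μ x = 1)
    (U : EuclideanSpace ℝ (Fin d) → ℝ)
    (hU : ∀ x, U x = -Real.log (μ x))
    (D : Fin K → Set (EuclideanSpace ℝ (Fin d)))
    (hDmeas : ∀ k, MeasurableSet (D k))
    (hDdisj : ∀ k l, k ≠ l → D k ∩ D l = ∅)
    (hDpos : ∀ k, 0 < ∫ x in D k, μ x)
    (ν : Fin K → EuclideanSpace ℝ (Fin d) → ℝ)
    (hνmeas : ∀ k, Measurable (ν k))
    (hνnonneg : ∀ k x, 0 ≤ ν k x)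
    (hνprob : ∀ k, ∫ x, ν k x = 1)
    (hνsupp : ∀ k, ∀ x ∉ D k, ν k x = 0)
    -- the conditioned densities `μ_k = μ 1_{D_k} / μ(D_k)`
    (μk : Fin K → EuclideanSpace ℝ (Fin d) → ℝ)
    (hμk : ∀ k x, μk k x = (D k).indicator μ x / ∫ y in D k, μ y)
    -- the conditional weights `q*_k = μ(D_k) / ∑_ℓ μ(D_ℓ)`
    (qstar : Fin K → ℝ)
    (hqstar : ∀ k, qstar k = (∫ y in D k, μ y) / ∑ l, ∫ y in D l, μ y)
    -- the Kullback–Leibler divergences `KL(ν_k | μ_k)`, assumed finite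
    (KLk : Fin K → ℝ)
    (hKLk : ∀ k, KLk k = ∫ x, ν k x * Real.log (ν k x / μk k x))
    (hKLfin : ∀ k, Integrable (fun x => ν k x * Real.log (ν k x / μk k x)))
    (hWfin : ∀ k, IntegrableOn (fun x => (U x + Real.log (ν k x)) * ν k x) (D k))
    (J : (Fin K → ℝ) → ℝ)
    (hJ : ∀ p, J p = ∑ k, p k *
      ∫ x in D k, (U x + Real.log (p k * ν k x)) * ν k x)
    (pbar : Fin K → ℝ)
    (hpbar : ∀ k, pbar k =
      qstar k * Real.exp (-KLk k) / ∑ l, qstar l * Real.exp (-KLk l)) :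
    ((∀ k, 0 ≤ pbar k) ∧ ∑ k, pbar k = 1) ∧
      (∀ p : Fin K → ℝ, (∀ k, 0 ≤ p k) → (∑ k, p k = 1) →
        J pbar ≤ J p ∧ (p ≠ pbar → J pbar < J p)) ∧
      ((∀ k x, ν k x = μk k x) → pbar = qstar) := by
  have : Nonempty (Fin K) := ⟨⟨0, hK⟩⟩
  set M : Fin K → ℝ := fun k => ∫ y in D k, μ y with hM
  have hMpos : ∀ k, 0 < M k := hDpos
  have hT : 0 < ∑ l, M l := Finset.sum_pos (fun l _ => hMpos l) Finset.univ_nonempty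
  have hqpos : ∀ k, 0 < qstar k := fun k => by
    rw [hqstar]; exact div_pos (hMpos k) hT
  have hqsum : ∑ k, qstar k = 1 := by
    simp_rw [hqstar]
    rw [← Finset.sum_div]
    exact div_self hT.ne'
  have hS : 0 < ∑ l, qstar l * Real.exp (-KLk l) :=
    Finset.sum_pos (fun l _ => mul_pos (hqpos l) (Real.exp_pos _)) Finset.univ_nonempty
  have hbpos : ∀ k, 0 < pbar k := fun k => by
    rw [hpbar]; exact div_pos (mul_pos (hqpos k) (Real.exp_pos _)) hS
  have hbsum : ∑ k, pbar k = 1 := by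
    simp_rw [hpbar]
    rw [← Finset.sum_div, div_self hS.ne']
  have hKL : ∀ k, KLk k =
      (∫ x in D k, (U x + Real.log (ν k x)) * ν k x) + Real.log (M k) := fun k => by
    rw [hKLk, ← setIntegral_eq_integral_of_forall_compl_eq_zero (s := D k)
      (fun x hx => by simp [hνsupp k x hx])]
    refine setIntegral_eq_add_of_density (hDmeas k) _ (hνprob k) (hνsupp k) (hWfin k)
      fun x hx => ?_
    rcases (hνnonneg k x).eq_or_lt with h0 | h0
    · simp [← h0]
    · rw [hμk, Set.indicator_of_mem hx,
        Real.log_div h0.ne' (div_pos (hμpos x) (hMpos k)).ne',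
        Real.log_div (hμpos x).ne' (hMpos k).ne', hU]
      ring
  have hterm : ∀ k (t : ℝ), t * ∫ x in D k, (U x + Real.log (t * ν k x)) * ν k x =
      t * ((∫ x in D k, (U x + Real.log (ν k x)) * ν k x) + Real.log t) := fun k t => by
    rcases eq_or_ne t 0 with rfl | ht
    · simp
    · congr 1
      refine setIntegral_eq_add_of_density (hDmeas k) _ (hνprob k) (hνsupp k) (hWfin k)
        fun x _ => ?_
      rcases (hνnonneg k x).eq_or_lt with h0 | h0
      · simp [← h0]
      · rw [Real.log_mul ht h0.ne']
        ring
  set C : ℝ := Real.log (∑ l, M l) + Real.log (∑ l, qstar l * Real.exp (-KLk l)) with hC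
  have hlog : ∀ k, Real.log (pbar k) = Real.log (M k) - KLk k - C := fun k => by
    rw [hpbar, Real.log_div (mul_pos (hqpos k) (Real.exp_pos _)).ne' hS.ne',
      Real.log_mul (hqpos k).ne' (Real.exp_pos _).ne', Real.log_exp, hqstar,
      Real.log_div (hMpos k).ne' hT.ne', hC]
    ring
  have hJeq : ∀ p : Fin K → ℝ, ∑ k, p k = 1 →
      J p = (∑ k, p k * (Real.log (p k) - Real.log (pbar k))) - C := fun p hp => by
    have hCsum : C = ∑ k, p k * C := by rw [← Finset.sum_mul, hp, one_mul]
    rw [hJ, hCsum, ← Finset.sum_sub_distrib]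
    refine Finset.sum_congr rfl fun k _ => ?_
    rw [hterm, hlog, hKL]
    ring
  have hJbar : J pbar = -C := by simp [hJeq pbar hbsum]
  refine ⟨⟨fun k => (hbpos k).le, hbsum⟩, fun p hp hp1 => ?_, fun hνμ => ?_⟩
  · have hsum : ∑ k, p k = ∑ k, pbar k := hp1.trans hbsum.symm
    rw [hJbar, hJeq p hp1]
    exact ⟨by linarith [sum_mul_log_sub_log_nonneg hp hbpos hsum],
      fun hne => by linarith [sum_mul_log_sub_log_pos hp hbpos hsum hne]⟩
  · have hKL0 : ∀ k, KLk k = 0 := fun k => by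
      rw [hKLk]
      refine integral_eq_zero_of_ae (.of_forall fun x => ?_)
      rcases eq_or_ne (μk k x) 0 with h0 | h0 <;> simp [hνμ, h0]
    funext k
    rw [hpbar]
    simp [hKL0, hqsum]
end

section
/- For weights W_1,…,W_K ∈ ℝ and step size δ > 0, consider the exponentiated gradient iteration on the simplex applied to the linear-plus-entropy objective F(p) = Σ_{k=1}^K p_k (ln p_k + W_k), namely p_k^{m+1} = p_k^m exp(-δ (1 + W_k + ln p_k^m)) / Σ_{ℓ=1}^K p_ℓ^m exp(-δ (1 + W_ℓ + ln p_ℓ^m)). Then for any initial condition p^0 in the interior of Δ_K and any δ ∈ (0,1], the iterates p^m converge as m → ∞ to the Gibbs weights p*_k = e^{-W_k} / Σ_{ℓ=1}^K e^{-W_ℓ}. -/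
open Filter Topology

/-- Along the exponentiated gradient iteration for the linear-plus-entropy objective, the
iterates are the Gibbs weights of the potentials `W k - (1 - δ) ^ m * (log (p 0 k) + W k)`. -/
theorem expGrad_eq_gibbs {ι : Type*} [Fintype ι] [Nonempty ι] (W : ι → ℝ) (δ : ℝ)
    (p : ℕ → ι → ℝ) (hp0_pos : ∀ k, 0 < p 0 k) (hp0_sum : ∑ k, p 0 k = 1)
    (hrec : ∀ m k, p (m + 1) k =
      p m k * Real.exp (-δ * (1 + W k + Real.log (p m k))) /
        ∑ l, p m l * Real.exp (-δ * (1 + W l + Real.log (p m l)))) (m : ℕ) (k : ι) :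
    p m k = Real.exp ((1 - δ) ^ m * (Real.log (p 0 k) + W k) - W k) /
      ∑ l, Real.exp ((1 - δ) ^ m * (Real.log (p 0 l) + W l) - W l) := by
  induction m generalizing k with
  | zero => simp [Real.exp_log (hp0_pos _), hp0_sum]
  | succ m ih =>
    set S := ∑ l, Real.exp ((1 - δ) ^ m * (Real.log (p 0 l) + W l) - W l) with hS
    have hSpos : 0 < S := Finset.sum_pos (fun _ _ => Real.exp_pos _) Finset.univ_nonempty
    have key : ∀ l, p m l * Real.exp (-δ * (1 + W l + Real.log (p m l))) =
        Real.exp ((1 - δ) ^ (m + 1) * (Real.log (p 0 l) + W l) - W l) *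
          Real.exp (-δ - (1 - δ) * Real.log S) := by
      intro l
      have hl : p m l =
          Real.exp ((1 - δ) ^ m * (Real.log (p 0 l) + W l) - W l - Real.log S) := by
        rw [Real.exp_sub, Real.exp_log hSpos, ih l]
      rw [hl, Real.log_exp, ← Real.exp_add, ← Real.exp_add]
      congr 1
      ring
    rw [hrec m k, key k, Finset.sum_congr rfl fun l _ => key l, ← Finset.sum_mul,
      mul_div_mul_right _ _ (Real.exp_pos _).ne']

/-- For weights `W₁, …, W_K` and step size `δ ∈ (0,1]`, the exponentiated
gradient iteration on the simplex for the objective `F(p) = ∑ k, p k (ln p k + W k)`, namely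
`p_k^{m+1} ∝ p_k^m exp(-δ(1 + W_k + ln p_k^m))`, started from any point in the interior of
the simplex, converges to the Gibbs weights `p*_k = e^{-W_k} / ∑_ℓ e^{-W_ℓ}`. -/
theorem stmt_17
    (K : ℕ) (hK : 0 < K)
    (W : Fin K → ℝ)
    (δ : ℝ) (hδ0 : 0 < δ) (hδ1 : δ ≤ 1)
    (p : ℕ → Fin K → ℝ)
    -- `p⁰` lies in the interior of the simplex
    (hp0_pos : ∀ k, 0 < p 0 k) (hp0_sum : ∑ k, p 0 k = 1)
    -- the exponentiated gradient iteration
    (hrec : ∀ m k, p (m + 1) k =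
      p m k * Real.exp (-δ * (1 + W k + Real.log (p m k))) /
        ∑ l, p m l * Real.exp (-δ * (1 + W l + Real.log (p m l))))
    (pstar : Fin K → ℝ)
    (hpstar : ∀ k, pstar k = Real.exp (-W k) / ∑ l, Real.exp (-W l)) :
    ∀ k, Tendsto (fun m => p m k) atTop (𝓝 (pstar k)) := by
  intro k
  have : Nonempty (Fin K) := ⟨⟨0, hK⟩⟩
  have hpow : Tendsto (fun m : ℕ => (1 - δ) ^ m) atTop (𝓝 0) :=
    tendsto_pow_atTop_nhds_zero_of_lt_one (by linarith) (by linarith)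
  have hexp : ∀ l, Tendsto
      (fun m : ℕ => Real.exp ((1 - δ) ^ m * (Real.log (p 0 l) + W l) - W l)) atTop
      (𝓝 (Real.exp (-W l))) := fun l => by
    have h := (hpow.mul_const (Real.log (p 0 l) + W l)).sub_const (W l)
    rw [zero_mul, zero_sub] at h
    exact (Real.continuous_exp.tendsto _).comp h
  have hne : ∑ l, Real.exp (-W l) ≠ 0 :=
    (Finset.sum_pos (fun _ _ => Real.exp_pos _) Finset.univ_nonempty).ne'
  rw [hpstar k]
  exact ((hexp k).div (tendsto_finsetSum _ fun l _ => hexp l) hne).congr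
    fun m => (expGrad_eq_gibbs W δ p hp0_pos hp0_sum hrec m k).symm
end
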